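/- With G = F₂ × F₂, Σ = {a, b, c, d, a⁻¹, b⁻¹, c⁻¹, d⁻¹} and π : Σ* → G as above, let T ⊆ Σ* be the set of words of the form (ca)^{x₁}(db)^{y₁}⋯(ca)^{x_n}(db)^{y_n}(b⁻¹)^{p₁}(d⁻¹a⁻¹)^{q₁}(c⁻¹b⁻¹)^{p₂}⋯(c⁻¹b⁻¹)^{p_t}(d⁻¹a⁻¹)^{q_t}(c⁻¹)^{p_{t+1}} with n, t ≥ 1 and all exponents positive, and let L = π⁻¹(1) be the word problem language of G. Let φ : Σ* → {a, b}* be the monoid homomorphism with φ(a) = a, φ(b) = b and φ(x) = ε for every other letter x ∈ Σ. Then φ(T ∩ L) = {(a^m b^m)^n : m, n ∈ ℕ, m, n ≥ 1}. -/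

import Mathlib

/-- The alphabet `Σ = {a, b, c, d, a⁻¹, b⁻¹, c⁻¹, d⁻¹}`. -/
inductive Letter : Type
  | a | b | c | d | A | B | C | D
  deriving DecidableEq

open Letter

/-- The free group of rank 2. -/
abbrev F2 : Type := FreeGroup (Fin 2)

/-- The group `G = F₂ × F₂`. -/
abbrev Gp : Type := F2 × F2

/-- The value of the projection `π` on each letter. -/
def letterVal : Letter → Gp
  | Letter.a => (FreeGroup.of 0, 1)
  | Letter.b => (FreeGroup.of 1, 1)
  | Letter.c => (1, FreeGroup.of 0)
  | Letter.d => (1, FreeGroup.of 1)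
  | Letter.A => ((FreeGroup.of 0)⁻¹, 1)
  | Letter.B => ((FreeGroup.of 1)⁻¹, 1)
  | Letter.C => (1, (FreeGroup.of 0)⁻¹)
  | Letter.D => (1, (FreeGroup.of 1)⁻¹)

/-- The monoid homomorphism `π : Σ* → G` induced by `letterVal`. -/
def π : FreeMonoid Letter →* Gp := FreeMonoid.lift letterVal

/-- The word
`(ca)^{x₁}(db)^{y₁}⋯(ca)^{x_n}(db)^{y_n} (b⁻¹)^{p₁}
 (d⁻¹a⁻¹)^{q₁}(c⁻¹b⁻¹)^{p₂}⋯(c⁻¹b⁻¹)^{p_t}(d⁻¹a⁻¹)^{q_t} (c⁻¹)^{p_{t+1}}`. -/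
def bigWord (n t : ℕ) (x y q p : ℕ → ℕ) : FreeMonoid Letter :=
  ((List.range n).map fun i =>
      (FreeMonoid.of c * FreeMonoid.of a) ^ x (i + 1) *
      (FreeMonoid.of d * FreeMonoid.of b) ^ y (i + 1)).prod *
  (FreeMonoid.of B) ^ p 1 *
  (FreeMonoid.of D * FreeMonoid.of A) ^ q 1 *
  ((List.range (t - 1)).map fun j =>
      (FreeMonoid.of C * FreeMonoid.of B) ^ p (j + 2) *
      (FreeMonoid.of D * FreeMonoid.of A) ^ q (j + 2)).prod *
  (FreeMonoid.of C) ^ p (t + 1)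

/-- The regular language `T` of all words of the above shape with `n, t ≥ 1`
and all exponents positive. -/
def Tlang : Set (FreeMonoid Letter) :=
  {w | ∃ n t : ℕ, ∃ x y q p : ℕ → ℕ, 1 ≤ n ∧ 1 ≤ t ∧
    (∀ i, 1 ≤ i → i ≤ n → 1 ≤ x i) ∧ (∀ i, 1 ≤ i → i ≤ n → 1 ≤ y i) ∧
    (∀ j, 1 ≤ j → j ≤ t → 1 ≤ q j) ∧ (∀ j, 1 ≤ j → j ≤ t + 1 → 1 ≤ p j) ∧
    w = bigWord n t x y q p}

/-- The word problem language `L = π⁻¹(1)` of `F₂ × F₂`. -/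
def WPlang : Set (FreeMonoid Letter) := {w | π w = 1}

/-- The erasing homomorphism `φ : Σ* → {a, b}*` with `φ(a) = a`, `φ(b) = b`
and `φ(x) = ε` for all other letters. -/
def φ : FreeMonoid Letter →* FreeMonoid (Fin 2) :=
  FreeMonoid.lift fun l => match l with
    | Letter.a => FreeMonoid.of 0
    | Letter.b => FreeMonoid.of 1
    | _ => 1

theorem List.replicate_append_inj {α : Type*} {s : α} {r r' : List α}
    (hr : r.head? ≠ some s) (hr' : r'.head? ≠ some s) :
    ∀ {k k' : ℕ}, List.replicate k s ++ r = List.replicate k' s ++ r' → k = k' ∧ r = r'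
  | 0, 0, h => by simpa using h
  | 0, k + 1, h => by
    simp only [List.replicate_zero, List.nil_append] at h
    simp [h, List.replicate_succ] at hr
  | k + 1, 0, h => by
    simp only [List.replicate_zero, List.nil_append] at h
    simp [← h, List.replicate_succ] at hr'
  | k + 1, k' + 1, h => by
    simp only [List.replicate_succ, List.cons_append, List.cons.injEq, true_and] at h
    simpa using List.replicate_append_inj hr hr' h

/-- The product `u^{x₁} v^{y₁} ⋯ u^{x_n} v^{y_n}` for a list of exponent pairs `(x_i, y_i)`. -/
def blockProd {M : Type*} [Monoid M] (u v : M) (l : List (ℕ × ℕ)) : M :=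
  (l.map fun e => u ^ e.1 * v ^ e.2).prod

theorem map_blockProd {M N : Type*} [Monoid M] [Monoid N] (f : M →* N) (u v : M)
    (l : List (ℕ × ℕ)) : f (blockProd u v l) = blockProd (f u) (f v) l := by
  simp [blockProd, map_list_prod, Function.comp_def]

theorem blockProd_cons {M : Type*} [Monoid M] (u v : M) (e : ℕ × ℕ) (l : List (ℕ × ℕ)) :
    blockProd u v (e :: l) = u ^ e.1 * v ^ e.2 * blockProd u v l := by
  simp [blockProd]

theorem FreeMonoid.toList_of_pow {α : Type*} (s : α) (k : ℕ) :
    (FreeMonoid.of s ^ k).toList = List.replicate k s := by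
  induction k with
  | zero => rfl
  | succ k ih => rw [pow_succ', FreeMonoid.toList_mul, ih]; rfl

theorem toList_blockProd_cons {α : Type*} (s t : α) (e : ℕ × ℕ) (l : List (ℕ × ℕ)) :
    (blockProd (FreeMonoid.of s) (FreeMonoid.of t) (e :: l)).toList =
      List.replicate e.1 s ++ (List.replicate e.2 t ++
        (blockProd (FreeMonoid.of s) (FreeMonoid.of t) l).toList) := by
  simp [blockProd_cons, FreeMonoid.toList_mul, FreeMonoid.toList_of_pow]

theorem head?_blockProd_ne {α : Type*} {s t : α} (hst : s ≠ t) {l : List (ℕ × ℕ)}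
    (hl : ∀ e ∈ l, 1 ≤ e.1 ∧ 1 ≤ e.2) :
    (blockProd (FreeMonoid.of s) (FreeMonoid.of t) l).toList.head? ≠ some t := by
  cases l with
  | nil => simp [blockProd]
  | cons e l =>
    obtain ⟨k, hk⟩ := Nat.exists_eq_add_of_le' (hl e (by simp)).1
    rw [toList_blockProd_cons, hk, List.replicate_succ]
    simpa using hst

theorem blockProd_freeMonoid_inj {α : Type*} {s t : α} (hst : s ≠ t) :
    ∀ {l l' : List (ℕ × ℕ)}, (∀ e ∈ l, 1 ≤ e.1 ∧ 1 ≤ e.2) → (∀ e ∈ l', 1 ≤ e.1 ∧ 1 ≤ e.2) →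
      (blockProd (FreeMonoid.of s) (FreeMonoid.of t) l).toList =
        (blockProd (FreeMonoid.of s) (FreeMonoid.of t) l').toList → l = l'
  | [], [], _, _, _ => rfl
  | [], e :: l, _, hl, h => by
    have he := (hl e (by simp)).1
    have h := congrArg List.length h
    rw [toList_blockProd_cons] at h
    simp [blockProd] at h
    omega
  | e :: l, [], hl, _, h => by
    have he := (hl e (by simp)).1
    have h := congrArg List.length h
    rw [toList_blockProd_cons] at h
    simp [blockProd] at h
    omega
  | e :: l, e' :: l', hl, hl', h => by
    have he := hl e (by simp)
    have he' := hl' e' (by simp)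
    rw [toList_blockProd_cons, toList_blockProd_cons] at h
    have head_ne : ∀ (k : ℕ) (r : List α), 1 ≤ k → (List.replicate k t ++ r).head? ≠ some s := by
      intro k r hk
      obtain ⟨k, rfl⟩ := Nat.exists_eq_add_of_le' hk
      simpa [List.replicate_succ] using hst.symm
    obtain ⟨h₁, h⟩ := List.replicate_append_inj (head_ne _ _ he.2) (head_ne _ _ he'.2) h
    have hl := fun e he => hl e (List.mem_cons_of_mem _ he)
    have hl' := fun e he => hl' e (List.mem_cons_of_mem _ he)
    obtain ⟨h₂, h⟩ := List.replicate_append_inj (head?_blockProd_ne hst hl)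
      (head?_blockProd_ne hst hl') h
    rw [blockProd_freeMonoid_inj hst hl hl' h, Prod.ext h₁ h₂]

theorem FreeGroup.lift_freeMonoid_eq_mk {α : Type*} (w : FreeMonoid α) :
    FreeMonoid.lift (FreeGroup.of : α → FreeGroup α) w =
      FreeGroup.mk (w.toList.map fun s => (s, true)) := by
  induction w using FreeMonoid.inductionOn' with
  | one => rfl
  | of_mul s w ih => rw [_root_.map_mul, ih]; rfl

theorem FreeGroup.lift_freeMonoid_injective {α : Type*} :
    Function.Injective (FreeMonoid.lift (FreeGroup.of : α → FreeGroup α)) := by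
  classical
  have toWord_eq : ∀ w : FreeMonoid α, (FreeMonoid.lift FreeGroup.of w).toWord =
      w.toList.map fun s => (s, true) := by
    intro w
    rw [FreeGroup.lift_freeMonoid_eq_mk, FreeGroup.toWord_mk]
    apply FreeGroup.IsReduced.reduce_eq
    simp only [FreeGroup.IsReduced, List.isChain_map]
    exact (List.pairwise_of_forall (by simp)).isChain
  intro w w' h
  have h := congrArg FreeGroup.toWord h
  rw [toWord_eq, toWord_eq] at h
  exact FreeMonoid.toList.injective (List.map_injective_iff.2 (fun _ _ h => by simpa using h) h)

theorem blockProd_freeGroup_inj {α : Type*} {s t : α} (hst : s ≠ t) {l l' : List (ℕ × ℕ)}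
    (hl : ∀ e ∈ l, 1 ≤ e.1 ∧ 1 ≤ e.2) (hl' : ∀ e ∈ l', 1 ≤ e.1 ∧ 1 ≤ e.2)
    (h : blockProd (FreeGroup.of s) (FreeGroup.of t) l =
      blockProd (FreeGroup.of s) (FreeGroup.of t) l') : l = l' := by
  refine blockProd_freeMonoid_inj hst hl hl' (congrArg _ (FreeGroup.lift_freeMonoid_injective ?_))
  simpa [map_blockProd] using h

/-- The exponent pairs `(f 0, g 0), …, (f (n - 1), g (n - 1))`. -/
def exponents (n : ℕ) (f g : ℕ → ℕ) : List (ℕ × ℕ) :=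
  (List.range n).map fun i => (f i, g i)

theorem forall_mem_exponents {n : ℕ} {f g : ℕ → ℕ} (hf : ∀ i < n, 1 ≤ f i)
    (hg : ∀ i < n, 1 ≤ g i) : ∀ e ∈ exponents n f g, 1 ≤ e.1 ∧ 1 ≤ e.2 := by
  simp only [exponents, List.mem_map, List.mem_range]
  rintro _ ⟨i, hi, rfl⟩
  exact ⟨hf i hi, hg i hi⟩

theorem exponents_inj {n n' : ℕ} {f g f' g' : ℕ → ℕ} (h : exponents n f g = exponents n' f' g') :
    n = n' ∧ ∀ i < n, f i = f' i ∧ g i = g' i := by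
  obtain rfl : n = n' := by simpa [exponents] using congrArg List.length h
  refine ⟨rfl, fun i hi => ?_⟩
  simpa using List.map_inj_left.1 h i (List.mem_range.2 hi)

theorem blockProd_exponents {M : Type*} [Monoid M] (u v : M) (n : ℕ) (f g : ℕ → ℕ) :
    blockProd u v (exponents n f g) =
      ((List.range n).map fun i => u ^ f i * v ^ g i).prod := by
  simp [blockProd, exponents, Function.comp_def]

theorem blockProd_const {M : Type*} [Monoid M] (u v : M) (n m : ℕ) (f g : ℕ → ℕ)
    (hf : ∀ i < n, f i = m) (hg : ∀ i < n, g i = m) :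
    blockProd u v (exponents n f g) = (u ^ m * v ^ m) ^ n := by
  rw [blockProd_exponents, List.map_congr_left (g := fun _ => u ^ m * v ^ m)]
  · simp
  · intro i hi
    rw [hf i (List.mem_range.1 hi), hg i (List.mem_range.1 hi)]

theorem fst_tail_eq {H : Type*} [Group H] (u v : H) (t : ℕ) (q p : ℕ → ℕ) :
    v⁻¹ ^ p 1 * u⁻¹ ^ q 1 *
        ((List.range t).map fun j => v⁻¹ ^ p (j + 2) * u⁻¹ ^ q (j + 2)).prod =
      (blockProd u v (exponents (t + 1) (fun i => q (t + 1 - i)) fun i => p (t + 1 - i)))⁻¹ := by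
  rw [blockProd_exponents]
  induction t with
  | zero => simp
  | succ t ih =>
    rw [List.range_succ_eq_map (n := t + 1), List.map_cons, List.prod_cons, mul_inv_rev]
    simp only [List.map_map, Function.comp_def, Nat.succ_eq_add_one, Nat.add_sub_add_right,
      Nat.sub_zero]
    rw [← ih, List.range_succ]
    simp [mul_assoc]

theorem snd_tail_eq {H : Type*} [Group H] (u v : H) (t : ℕ) (q p : ℕ → ℕ) :
    v⁻¹ ^ q 1 * ((List.range t).map fun j => u⁻¹ ^ p (j + 2) * v⁻¹ ^ q (j + 2)).prod *
        u⁻¹ ^ p (t + 2) =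
      (blockProd u v (exponents (t + 1) (fun i => p (t + 2 - i)) fun i => q (t + 1 - i)))⁻¹ := by
  rw [blockProd_exponents]
  induction t with
  | zero => simp
  | succ t ih =>
    rw [List.range_succ_eq_map (n := t + 1), List.map_cons, List.prod_cons, mul_inv_rev]
    simp only [Nat.reduceSubDiff, List.map_map, Function.comp_def, Nat.succ_eq_add_one,
      Nat.add_sub_add_right, Nat.sub_zero]
    rw [← ih, List.range_succ]
    simp [mul_assoc]

theorem Prod.fst_list_prod {M N : Type*} [Monoid M] [Monoid N] (l : List (M × N)) :
    l.prod.1 = (l.map Prod.fst).prod :=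
  map_list_prod (MonoidHom.fst M N) l

theorem Prod.snd_list_prod {M N : Type*} [Monoid M] [Monoid N] (l : List (M × N)) :
    l.prod.2 = (l.map Prod.snd).prod :=
  map_list_prod (MonoidHom.snd M N) l

theorem fst_π_bigWord (n t : ℕ) (x y q p : ℕ → ℕ) :
    (π (bigWord n (t + 1) x y q p)).1 =
      blockProd (FreeGroup.of 0) (FreeGroup.of 1)
          (exponents n (fun i => x (i + 1)) fun i => y (i + 1)) *
        (blockProd (FreeGroup.of 0) (FreeGroup.of 1)
          (exponents (t + 1) (fun i => q (t + 1 - i)) fun i => p (t + 1 - i)))⁻¹ := by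
  rw [← fst_tail_eq, blockProd_exponents]
  simp [bigWord, π, letterVal, map_list_prod, Prod.fst_list_prod, Function.comp_def, mul_assoc]

theorem snd_π_bigWord (n t : ℕ) (x y q p : ℕ → ℕ) :
    (π (bigWord n (t + 1) x y q p)).2 =
      blockProd (FreeGroup.of 0) (FreeGroup.of 1)
          (exponents n (fun i => x (i + 1)) fun i => y (i + 1)) *
        (blockProd (FreeGroup.of 0) (FreeGroup.of 1)
          (exponents (t + 1) (fun i => p (t + 2 - i)) fun i => q (t + 1 - i)))⁻¹ := by
  rw [← snd_tail_eq, blockProd_exponents]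
  simp [bigWord, π, letterVal, map_list_prod, Prod.snd_list_prod, Function.comp_def, mul_assoc]

theorem φ_bigWord (n t : ℕ) (x y q p : ℕ → ℕ) :
    φ (bigWord n t x y q p) =
      blockProd (FreeMonoid.of 0) (FreeMonoid.of 1)
        (exponents n (fun i => x (i + 1)) fun i => y (i + 1)) := by
  rw [blockProd_exponents]
  simp [bigWord, φ, map_list_prod, Function.comp_def]

/-- `φ(T ∩ L) = {(a^m b^m)^n : m, n ≥ 1}`. -/
theorem image_T_inter_WP :
    φ '' (Tlang ∩ WPlang) =
      {w : FreeMonoid (Fin 2) | ∃ m n : ℕ, 1 ≤ m ∧ 1 ≤ n ∧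
        w = (FreeMonoid.of 0 ^ m * FreeMonoid.of 1 ^ m) ^ n} := by
  ext w
  constructor
  · rintro ⟨_, ⟨⟨n, t, x, y, q, p, hn, ht, hx, hy, hq, hp, rfl⟩, hw⟩, rfl⟩
    obtain ⟨t, rfl⟩ := Nat.exists_eq_add_of_le' ht
    have h₁ := congrArg Prod.fst hw
    have h₂ := congrArg Prod.snd hw
    rw [fst_π_bigWord, Prod.fst_one, mul_inv_eq_one] at h₁
    rw [snd_π_bigWord, Prod.snd_one, mul_inv_eq_one] at h₂
    have hxy := forall_mem_exponents (n := n) (f := fun i => x (i + 1)) (g := fun i => y (i + 1))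
      (fun i hi => hx _ (by omega) (by omega)) (fun i hi => hy _ (by omega) (by omega))
    obtain ⟨rfl, e₁⟩ := exponents_inj <| blockProd_freeGroup_inj (by decide) hxy
      (forall_mem_exponents (fun i hi => hq _ (by omega) (by omega))
        fun i hi => hp _ (by omega) (by omega)) h₁
    obtain ⟨-, e₂⟩ := exponents_inj <| blockProd_freeGroup_inj (by decide) hxy
      (forall_mem_exponents (fun i hi => hp _ (by omega) (by omega))
        fun i hi => hq _ (by omega) (by omega)) h₂
    have hyx : ∀ i < t + 1, y (i + 1) = x (i + 1) := fun i hi =>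
      (e₂ i hi).2.trans (e₁ i hi).1.symm
    have hx_const : ∀ i < t + 1, x (i + 1) = x 1 := by
      intro i
      induction i with
      | zero => simp
      | succ i ih =>
        intro hi
        have h := (e₂ (i + 1) hi).1
        rw [show t + 2 - (i + 1) = t + 1 - i by omega] at h
        rw [← ih (by omega), ← hyx i (by omega), h]
        exact (e₁ i (by omega)).2.symm
    refine ⟨x 1, t + 1, hx 1 le_rfl hn, hn, ?_⟩
    rw [φ_bigWord]
    exact blockProd_const _ _ _ _ _ _ hx_const fun i hi => (hyx i hi).trans (hx_const i hi)
  · rintro ⟨m, n, hm, hn, rfl⟩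
    obtain ⟨n, rfl⟩ := Nat.exists_eq_add_of_le' hn
    let k : ℕ → ℕ := fun _ => m
    refine ⟨bigWord (n + 1) (n + 1) k k k k, ⟨⟨n + 1, n + 1, k, k, k, k, hn, hn, fun _ _ _ => hm,
      fun _ _ _ => hm, fun _ _ _ => hm, fun _ _ _ => hm, rfl⟩, ?_⟩, ?_⟩
    · exact Prod.ext ((fst_π_bigWord ..).trans (mul_inv_cancel _))
        ((snd_π_bigWord ..).trans (mul_inv_cancel _))
    · rw [φ_bigWord]
      exact blockProd_const _ _ _ _ _ _ (fun _ _ => rfl) fun _ _ => rfl
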